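/- arXiv:2406.16703 — 4 statements merged into one kernel-verified Lean document; each statement's English description precedes it below -/
import Mathlib

section
/- Let d ≥ 1 be an integer and let ρ ∈ [3,4] be a real number. There exists a constant C > 0, depending only on ρ, such that for all x, y ∈ ℝ^d: (Φ_ρ(x) − Φ_ρ(y)) · (x − y) ≥ C·|x − y|^ρ. -/
open scoped RealInnerProductSpace

/-- The Forchheimer nonlinearity `Φ_ρ(x) = |x|^{ρ-2} x` (with `Φ_ρ(0) = 0`). -/
noncomputable def forchheimer (ρ : ℝ) {d : ℕ} (x : EuclideanSpace ℝ (Fin d)) :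
    EuclideanSpace ℝ (Fin d) :=
  ‖x‖ ^ (ρ - 2) • x

/-- **Strong monotonicity of the Forchheimer nonlinearity.** For `ρ ∈ [3,4]` there exists
`C > 0`, depending only on `ρ`, such that for all `x, y ∈ ℝ^d`,
`(Φ_ρ(x) − Φ_ρ(y)) · (x − y) ≥ C·|x − y|^ρ`. -/
theorem forchheimer_strong_monotonicity (ρ : ℝ) (hρ₁ : 3 ≤ ρ) (hρ₂ : ρ ≤ 4) :
    ∃ C : ℝ, 0 < C ∧ ∀ (d : ℕ), 1 ≤ d → ∀ x y : EuclideanSpace ℝ (Fin d),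
      C * ‖x - y‖ ^ ρ ≤ ⟪forchheimer ρ x - forchheimer ρ y, x - y⟫ := by
  refine ⟨(1/2) * (1/2) ^ (ρ - 2), by positivity, ?_⟩
  intro d _ x y
  have hs : 0 ≤ ρ - 2 := by linarith
  have key : ⟪forchheimer ρ x - forchheimer ρ y, x - y⟫
      = (‖x‖ ^ (ρ - 2) + ‖y‖ ^ (ρ - 2)) / 2 * ‖x - y‖ ^ 2
        + (‖x‖ ^ (ρ - 2) - ‖y‖ ^ (ρ - 2)) * (‖x‖ ^ 2 - ‖y‖ ^ 2) / 2 := by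
    rw [norm_sub_sq_real]
    simp only [forchheimer, inner_sub_left, inner_sub_right, real_inner_smul_left,
      real_inner_self_eq_norm_sq, real_inner_comm x y]
    ring
  have hmono : 0 ≤ (‖x‖ ^ (ρ - 2) - ‖y‖ ^ (ρ - 2)) * (‖x‖ ^ 2 - ‖y‖ ^ 2) := by
    rcases le_total ‖x‖ ‖y‖ with h | h
    · have h1 := Real.rpow_le_rpow (norm_nonneg x) h hs
      have h2 := pow_le_pow_left₀ (norm_nonneg x) h 2
      exact mul_nonneg_of_nonpos_of_nonpos (by linarith) (by linarith)
    · have h1 := Real.rpow_le_rpow (norm_nonneg y) h hs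
      have h2 := pow_le_pow_left₀ (norm_nonneg y) h 2
      exact mul_nonneg (by linarith) (by linarith)
  have hx : 0 ≤ ‖x‖ ^ (ρ - 2) := by positivity
  have hy : 0 ≤ ‖y‖ ^ (ρ - 2) := by positivity
  have htri := norm_sub_le x y
  have hbound : (1 / 2 * ‖x - y‖) ^ (ρ - 2) ≤ ‖x‖ ^ (ρ - 2) + ‖y‖ ^ (ρ - 2) := by
    rcases le_total ‖x‖ ‖y‖ with h | h
    · have h1 : (1 / 2 * ‖x - y‖) ^ (ρ - 2) ≤ ‖y‖ ^ (ρ - 2) :=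
        Real.rpow_le_rpow (by positivity) (by linarith) hs
      linarith
    · have h1 : (1 / 2 * ‖x - y‖) ^ (ρ - 2) ≤ ‖x‖ ^ (ρ - 2) :=
        Real.rpow_le_rpow (by positivity) (by linarith) hs
      linarith
  rw [Real.mul_rpow (by norm_num) (norm_nonneg _)] at hbound
  have hpow : ‖x - y‖ ^ ρ = ‖x - y‖ ^ (ρ - 2) * ‖x - y‖ ^ 2 := by
    rw [← Real.rpow_natCast, ← Real.rpow_add_of_nonneg (norm_nonneg _) hs (by norm_num)]
    congr 1
    push_cast
    ring
  have h3 := mul_le_mul_of_nonneg_right hbound (sq_nonneg ‖x - y‖)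
  rw [key, hpow]
  linarith
end

section
/- Let d ≥ 1 be an integer, ρ ∈ [3,4] a real number, υ := ρ/(ρ−1), and Ω ⊆ ℝ^d a measurable set. There exists a constant c_ρ > 0, depending only on ρ, such that for all measurable functions u, v : Ω → ℝ^d with ‖u‖_{L^ρ(Ω)} < ∞ and ‖v‖_{L^ρ(Ω)} < ∞, the function Φ_ρ(u) − Φ_ρ(v) has finite L^υ(Ω) norm and ‖Φ_ρ(u) − Φ_ρ(v)‖_{L^υ(Ω)} ≤ c_ρ·(‖u‖_{L^ρ(Ω)} + ‖v‖_{L^ρ(Ω)})^{ρ−2}·‖u − v‖_{L^ρ(Ω)}. -/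
open MeasureTheory

/-- The `L^p(Ω)` norm `(∫_Ω |w|^p)^{1/p}` of a vector field `w : ℝ^d → ℝ^d`. -/
noncomputable def lpNormOn {d : ℕ} (p : ℝ) (Ω : Set (EuclideanSpace ℝ (Fin d)))
    (w : EuclideanSpace ℝ (Fin d) → EuclideanSpace ℝ (Fin d)) : ℝ :=
  (∫ x in Ω, ‖w x‖ ^ p) ^ (1 / p)

lemma forch_aux {s a b : ℝ} (hs : 1 ≤ s) (hb : 0 ≤ b) (hab : b ≤ a) :
    (a ^ s - b ^ s) * b ≤ s * a ^ s * (a - b) := by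
  rcases (hb.trans hab).eq_or_lt with h | ha
  · have : b = 0 := by linarith
    subst this; subst h; simp
  have h1 := one_add_mul_self_le_rpow_one_add (s := b / a - 1) (p := s)
    (by have : 0 ≤ b / a := by positivity
        linarith) hs
  have h2 : 1 + (b / a - 1) = b / a := by ring
  rw [h2, Real.div_rpow hb ha.le, le_div_iff₀ (by positivity)] at h1
  have hA : 0 < a ^ s := by positivity
  have h3 : a ^ s - b ^ s ≤ s * a ^ s * (1 - b / a) := by linarith
  have h4 : 0 ≤ 1 - b / a := by
    rw [sub_nonneg, div_le_one ha]; exact hab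
  calc (a ^ s - b ^ s) * b ≤ (s * a ^ s * (1 - b / a)) * b := by gcongr
    _ ≤ (s * a ^ s * (1 - b / a)) * a := by gcongr
    _ = s * a ^ s * (a - b) := by field_simp

lemma forch_pt_aux {ρ : ℝ} (hρ : 3 ≤ ρ) {d : ℕ} (x y : EuclideanSpace ℝ (Fin d))
    (h : ‖y‖ ≤ ‖x‖) :
    ‖forchheimer ρ x - forchheimer ρ y‖ ≤ (ρ - 1) * (‖x‖ + ‖y‖) ^ (ρ - 2) * ‖x - y‖ := by
  unfold forchheimer
  have e : ‖x‖ ^ (ρ - 2) • x - ‖y‖ ^ (ρ - 2) • y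
      = ‖x‖ ^ (ρ - 2) • (x - y) + (‖x‖ ^ (ρ - 2) - ‖y‖ ^ (ρ - 2)) • y := by
    rw [smul_sub, sub_smul]; abel
  have hm : ‖y‖ ^ (ρ - 2) ≤ ‖x‖ ^ (ρ - 2) :=
    Real.rpow_le_rpow (norm_nonneg _) h (by linarith)
  have hm2 : ‖x‖ ^ (ρ - 2) ≤ (‖x‖ + ‖y‖) ^ (ρ - 2) :=
    Real.rpow_le_rpow (norm_nonneg _) (by linarith [norm_nonneg y]) (by linarith)
  have hx : 0 ≤ ‖x‖ ^ (ρ - 2) := by positivity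
  have ha := forch_aux (s := ρ - 2) (by linarith) (norm_nonneg y) h
  have hn : ‖x‖ - ‖y‖ ≤ ‖x - y‖ := norm_sub_norm_le x y
  rw [e]
  refine (norm_add_le _ _).trans ?_
  rw [norm_smul, norm_smul, Real.norm_of_nonneg hx, Real.norm_of_nonneg (sub_nonneg.2 hm)]
  have h5 : (ρ - 2) * ‖x‖ ^ (ρ - 2) * (‖x‖ - ‖y‖) ≤ (ρ - 2) * ‖x‖ ^ (ρ - 2) * ‖x - y‖ :=
    mul_le_mul_of_nonneg_left hn (mul_nonneg (by linarith) hx)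
  have h6 : (ρ - 1) * ‖x‖ ^ (ρ - 2) * ‖x - y‖
      ≤ (ρ - 1) * (‖x‖ + ‖y‖) ^ (ρ - 2) * ‖x - y‖ :=
    mul_le_mul_of_nonneg_right (mul_le_mul_of_nonneg_left hm2 (by linarith)) (norm_nonneg _)
  linarith

lemma forch_pt {ρ : ℝ} (hρ : 3 ≤ ρ) {d : ℕ} (x y : EuclideanSpace ℝ (Fin d)) :
    ‖forchheimer ρ x - forchheimer ρ y‖ ≤ (ρ - 1) * (‖x‖ + ‖y‖) ^ (ρ - 2) * ‖x - y‖ := by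
  rcases le_total ‖y‖ ‖x‖ with h | h
  · exact forch_pt_aux hρ x y h
  · rw [norm_sub_rev, norm_sub_rev x y, add_comm]
    exact forch_pt_aux hρ y x h

lemma lpNormOn_eq {d : ℕ} {p : ℝ} (hp : 0 < p) {Ω : Set (EuclideanSpace ℝ (Fin d))}
    {w : EuclideanSpace ℝ (Fin d) → EuclideanSpace ℝ (Fin d)}
    (hw : MemLp w (ENNReal.ofReal p) (volume.restrict Ω)) :
    lpNormOn p Ω w = (eLpNorm w (ENNReal.ofReal p) (volume.restrict Ω)).toReal := by
  rw [hw.eLpNorm_eq_integral_rpow_norm (by simpa using hp) ENNReal.ofReal_ne_top,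
    ENNReal.toReal_ofReal hp.le, ENNReal.toReal_ofReal (by positivity), lpNormOn, one_div]

lemma memLp_iff_aux {d : ℕ} {p : ℝ} (hp : 0 < p) {Ω : Set (EuclideanSpace ℝ (Fin d))}
    {w : EuclideanSpace ℝ (Fin d) → EuclideanSpace ℝ (Fin d)} (hw : Measurable w) :
    IntegrableOn (fun x => ‖w x‖ ^ p) Ω ↔ MemLp w (ENNReal.ofReal p) (volume.restrict Ω) := by
  have := integrable_norm_rpow_iff (μ := volume.restrict Ω) (p := ENNReal.ofReal p)
    hw.aestronglyMeasurable (by simpa using hp) ENNReal.ofReal_ne_top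
  rwa [ENNReal.toReal_ofReal hp.le] at this

/-- **`L^υ`-Lipschitz bound for the Forchheimer nonlinearity.** For `ρ ∈ [3,4]` and
`υ = ρ/(ρ−1)` there exists `c_ρ > 0`, depending only on `ρ`, such that for all measurable
sets `Ω ⊆ ℝ^d` and all measurable `u, v` with finite `L^ρ(Ω)` norm, the function
`Φ_ρ(u) − Φ_ρ(v)` has finite `L^υ(Ω)` norm and
`‖Φ_ρ(u) − Φ_ρ(v)‖_{L^υ(Ω)} ≤ c_ρ·(‖u‖_{L^ρ(Ω)} + ‖v‖_{L^ρ(Ω)})^{ρ−2}·‖u − v‖_{L^ρ(Ω)}`. -/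
theorem forchheimer_Lp_lipschitz (ρ : ℝ) (hρ₁ : 3 ≤ ρ) (hρ₂ : ρ ≤ 4) :
    ∃ c : ℝ, 0 < c ∧ ∀ (d : ℕ), 1 ≤ d →
      ∀ (Ω : Set (EuclideanSpace ℝ (Fin d))), MeasurableSet Ω →
      ∀ (u v : EuclideanSpace ℝ (Fin d) → EuclideanSpace ℝ (Fin d)),
        Measurable u → Measurable v →
        IntegrableOn (fun x => ‖u x‖ ^ ρ) Ω →
        IntegrableOn (fun x => ‖v x‖ ^ ρ) Ω →
        IntegrableOn
            (fun x => ‖forchheimer ρ (u x) - forchheimer ρ (v x)‖ ^ (ρ / (ρ - 1))) Ω ∧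
          lpNormOn (ρ / (ρ - 1)) Ω (fun x => forchheimer ρ (u x) - forchheimer ρ (v x)) ≤
            c * (lpNormOn ρ Ω u + lpNormOn ρ Ω v) ^ (ρ - 2) *
              lpNormOn ρ Ω (fun x => u x - v x) := by
  refine ⟨ρ - 1, by linarith, ?_⟩
  intro d _ Ω hΩ u v hu hv hui hvi
  have hυ : 0 < ρ / (ρ - 1) := div_pos (by linarith) (by linarith)
  have hρ0 : 0 < ρ := by linarith
  have hs0 : 0 < ρ - 2 := by linarith
  have hmeas : Measurable (fun x => forchheimer ρ (u x) - forchheimer ρ (v x)) := by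
    unfold forchheimer
    fun_prop
  rw [memLp_iff_aux hρ0 hu] at hui
  rw [memLp_iff_aux hρ0 hv] at hvi
  rw [memLp_iff_aux hυ hmeas]
  have huv : MemLp (fun x => u x - v x) (ENNReal.ofReal ρ) (volume.restrict Ω) := hui.sub hvi
  set μ := volume.restrict Ω with hμ
  set g : EuclideanSpace ℝ (Fin d) → ℝ := fun x => ‖u x‖ + ‖v x‖ with hg
  have hgm : Measurable g := by fun_prop
  have hgs : Measurable (fun x => ‖g x‖ ^ (ρ - 2)) := by fun_prop
  have hT : ENNReal.HolderTriple (ENNReal.ofReal (ρ / (ρ - 2))) (ENNReal.ofReal ρ)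
      (ENNReal.ofReal (ρ / (ρ - 1))) := by
    constructor
    rw [← ENNReal.ofReal_inv_of_pos (by positivity), ← ENNReal.ofReal_inv_of_pos hρ0,
      ← ENNReal.ofReal_inv_of_pos hυ, ← ENNReal.ofReal_add (by positivity) (by positivity)]
    congr 1
    rw [inv_div, inv_div]
    field_simp
    ring
  have hgn : eLpNorm g (ENNReal.ofReal ρ) μ
      ≤ eLpNorm u (ENNReal.ofReal ρ) μ + eLpNorm v (ENNReal.ofReal ρ) μ := by
    have := eLpNorm_add_le (μ := μ) (p := ENNReal.ofReal ρ) (f := fun x => ‖u x‖)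
      (g := fun x => ‖v x‖)
      hu.norm.aestronglyMeasurable hv.norm.aestronglyMeasurable
      (by rw [ENNReal.one_le_ofReal]; linarith)
    rwa [eLpNorm_norm, eLpNorm_norm] at this
  have hpow : eLpNorm (fun x => ‖g x‖ ^ (ρ - 2)) (ENNReal.ofReal (ρ / (ρ - 2))) μ
      ≤ (eLpNorm u (ENNReal.ofReal ρ) μ + eLpNorm v (ENNReal.ofReal ρ) μ) ^ (ρ - 2) := by
    rw [eLpNorm_norm_rpow g hs0, ← ENNReal.ofReal_mul (by positivity),
      div_mul_cancel₀ _ hs0.ne']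
    exact ENNReal.rpow_le_rpow hgn hs0.le
  have hH := eLpNorm_smul_le_mul_eLpNorm (μ := μ) (hpqr := hT) huv.1 hgs.aestronglyMeasurable
  have hC : eLpNorm (fun x => forchheimer ρ (u x) - forchheimer ρ (v x))
      (ENNReal.ofReal (ρ / (ρ - 1))) μ
      ≤ ENNReal.ofReal (ρ - 1) * eLpNorm ((fun x => ‖g x‖ ^ (ρ - 2)) • (fun x => u x - v x))
        (ENNReal.ofReal (ρ / (ρ - 1))) μ := by
    refine eLpNorm_le_mul_eLpNorm_of_ae_le_mul (Filter.Eventually.of_forall fun x => ?_) _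
    have h1 := forch_pt hρ₁ (u x) (v x)
    have h2 : ‖g x‖ = ‖u x‖ + ‖v x‖ := Real.norm_of_nonneg (by positivity)
    rw [Pi.smul_apply', norm_smul, Real.norm_of_nonneg (by positivity), h2, ← mul_assoc]
    exact h1
  have hB : eLpNorm (fun x => forchheimer ρ (u x) - forchheimer ρ (v x))
      (ENNReal.ofReal (ρ / (ρ - 1))) μ
      ≤ ENNReal.ofReal (ρ - 1) * (eLpNorm u (ENNReal.ofReal ρ) μ
        + eLpNorm v (ENNReal.ofReal ρ) μ) ^ (ρ - 2)
        * eLpNorm (fun x => u x - v x) (ENNReal.ofReal ρ) μ := by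
    rw [mul_assoc]
    exact hC.trans (mul_le_mul_right (hH.trans (mul_le_mul_left hpow _)) _)
  have hfin : ENNReal.ofReal (ρ - 1) * (eLpNorm u (ENNReal.ofReal ρ) μ
        + eLpNorm v (ENNReal.ofReal ρ) μ) ^ (ρ - 2)
        * eLpNorm (fun x => u x - v x) (ENNReal.ofReal ρ) μ ≠ ⊤ :=
    ENNReal.mul_ne_top (ENNReal.mul_ne_top ENNReal.ofReal_ne_top
      (ENNReal.rpow_ne_top_of_nonneg hs0.le (ENNReal.add_ne_top.2 ⟨hui.2.ne, hvi.2.ne⟩)))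
      huv.2.ne
  have hM : MemLp (fun x => forchheimer ρ (u x) - forchheimer ρ (v x))
      (ENNReal.ofReal (ρ / (ρ - 1))) μ :=
    ⟨hmeas.aestronglyMeasurable, hB.trans_lt hfin.lt_top⟩
  refine ⟨hM, ?_⟩
  rw [lpNormOn_eq hυ hM, lpNormOn_eq hρ0 hui, lpNormOn_eq hρ0 hvi, lpNormOn_eq hρ0 huv]
  have := ENNReal.toReal_mono hfin hB
  rwa [ENNReal.toReal_mul, ENNReal.toReal_mul, ← ENNReal.toReal_rpow,
    ENNReal.toReal_add hui.2.ne hvi.2.ne, ENNReal.toReal_ofReal (by linarith)] at this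
end

section
/- Let d ≥ 1 be an integer, ρ ∈ [3,4] a real number, and Ω ⊆ ℝ^d a measurable set. For all measurable functions u, v : Ω → ℝ^d with ‖u‖_{L^ρ(Ω)} < ∞ and ‖v‖_{L^ρ(Ω)} < ∞, the function x ↦ Φ_ρ(u(x))·(u(x) − v(x)) is integrable on Ω and ∫_Ω Φ_ρ(u)·(u − v) dx ≥ (1/ρ)·(‖u‖_{L^ρ(Ω)}^ρ − ‖v‖_{L^ρ(Ω)}^ρ). -/
open MeasureTheory
open scoped RealInnerProductSpace

theorem forch_young (ρ a b : ℝ) (h : 3 ≤ ρ) (ha : 0 ≤ a) (hb : 0 ≤ b) :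
    a ^ (ρ - 2) * a * b ≤ (1 - 1 / ρ) * a ^ ρ + (1 / ρ) * b ^ ρ := by
  have hρ : 0 < ρ := by linarith
  have h1 : 1 / ρ ≤ 1 := by
    rw [div_le_one hρ]; linarith
  have key := Real.geom_mean_le_arith_mean2_weighted (w₁ := 1 - 1 / ρ) (w₂ := 1 / ρ)
    (p₁ := a ^ ρ) (p₂ := b ^ ρ) (by linarith) (by positivity) (by positivity)
    (by positivity) (by ring)
  rw [← Real.rpow_mul ha, ← Real.rpow_mul hb] at key
  have e1 : ρ * (1 - 1 / ρ) = (ρ - 2) + 1 := by field_simp; ring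
  have e2 : ρ * (1 / ρ) = 1 := by field_simp
  rw [e1, e2, Real.rpow_one, Real.rpow_add_of_nonneg ha (by linarith) (by norm_num),
    Real.rpow_one] at key
  exact key

theorem forch_point (d : ℕ) (ρ : ℝ) (h : 3 ≤ ρ) (x y : EuclideanSpace ℝ (Fin d)) :
    (1 / ρ) * (‖x‖ ^ ρ - ‖y‖ ^ ρ) ≤ ⟪forchheimer ρ x, x - y⟫ ∧
    |⟪forchheimer ρ x, x - y⟫| ≤ 2 * ‖x‖ ^ ρ + ‖y‖ ^ ρ := by
  have hρ : 0 < ρ := by linarith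
  have h0 : 0 < 1 / ρ := by positivity
  have h1 : 1 / ρ ≤ 1 := by
    rw [div_le_one hρ]; linarith
  have hY := forch_young ρ ‖x‖ ‖y‖ h (norm_nonneg _) (norm_nonneg _)
  have hA : 0 ≤ ‖x‖ ^ ρ := by positivity
  have hB : 0 ≤ ‖y‖ ^ ρ := by positivity
  have hp : 0 ≤ ‖x‖ ^ (ρ - 2) := by positivity
  have e : ‖x‖ ^ (ρ - 2) * (‖x‖ * ‖x‖) = ‖x‖ ^ ρ := by
    have : ρ = (ρ - 2) + 1 + 1 := by ring
    conv_rhs => rw [this, Real.rpow_add_of_nonneg (norm_nonneg _) (by linarith) (by norm_num),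
      Real.rpow_add_of_nonneg (norm_nonneg _) (by linarith) (by norm_num), Real.rpow_one]
    ring
  have e3 : ⟪forchheimer ρ x, x - y⟫ = ‖x‖ ^ ρ - ‖x‖ ^ (ρ - 2) * ⟪x, y⟫ := by
    rw [forchheimer, real_inner_smul_left, inner_sub_right, real_inner_self_eq_norm_mul_norm,
      mul_sub, e]
  have hc := abs_le.1 (abs_real_inner_le_norm x y)
  have c1 := mul_le_mul_of_nonneg_left hc.1 hp
  have c2 := mul_le_mul_of_nonneg_left hc.2 hp
  have m1 := mul_le_mul_of_nonneg_right h1 hB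
  have m2 := mul_nonneg h0.le hA
  rw [e3, abs_le]
  refine ⟨?_, ?_, ?_⟩ <;> nlinarith

theorem forch_norm {d : ℕ} (ρ : ℝ) (h : 3 ≤ ρ) (Ω : Set (EuclideanSpace ℝ (Fin d)))
    (w : EuclideanSpace ℝ (Fin d) → EuclideanSpace ℝ (Fin d)) :
    lpNormOn ρ Ω w ^ ρ = ∫ x in Ω, ‖w x‖ ^ ρ := by
  have hρ : ρ ≠ 0 := by linarith
  rw [lpNormOn, ← Real.rpow_mul (integral_nonneg fun x => by positivity),
    one_div_mul_cancel hρ, Real.rpow_one]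

/-- **Integrated convexity inequality for the Forchheimer term.** For `ρ ∈ [3,4]`, a
measurable set `Ω ⊆ ℝ^d`, and measurable `u, v` with finite `L^ρ(Ω)` norms, the function
`x ↦ Φ_ρ(u x)·(u x − v x)` is integrable on `Ω` and
`∫_Ω Φ_ρ(u)·(u − v) ≥ (1/ρ)·(‖u‖_{L^ρ(Ω)}^ρ − ‖v‖_{L^ρ(Ω)}^ρ)`. -/
theorem forchheimer_integral_convexity (d : ℕ) (hd : 1 ≤ d) (ρ : ℝ)
    (hρ₁ : 3 ≤ ρ) (hρ₂ : ρ ≤ 4)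
    (Ω : Set (EuclideanSpace ℝ (Fin d))) (hΩ : MeasurableSet Ω)
    (u v : EuclideanSpace ℝ (Fin d) → EuclideanSpace ℝ (Fin d))
    (hu : Measurable u) (hv : Measurable v)
    (hui : IntegrableOn (fun x => ‖u x‖ ^ ρ) Ω)
    (hvi : IntegrableOn (fun x => ‖v x‖ ^ ρ) Ω) :
    IntegrableOn (fun x => ⟪forchheimer ρ (u x), u x - v x⟫) Ω ∧
      (1 / ρ) * (lpNormOn ρ Ω u ^ ρ - lpNormOn ρ Ω v ^ ρ) ≤
        ∫ x in Ω, ⟪forchheimer ρ (u x), u x - v x⟫ := by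
  have hI : IntegrableOn (fun x => ⟪forchheimer ρ (u x), u x - v x⟫) Ω := by
    refine Integrable.mono' ((hui.const_mul 2).add hvi) ?_ ?_
    · have : Measurable (fun x => ⟪forchheimer ρ (u x), u x - v x⟫) := by
        unfold forchheimer
        exact ((hu.norm.pow_const _).smul hu).inner (hu.sub hv)
      exact this.aestronglyMeasurable
    · exact Filter.Eventually.of_forall fun x => (forch_point d ρ hρ₁ (u x) (v x)).2
  refine ⟨hI, ?_⟩
  rw [forch_norm ρ hρ₁, forch_norm ρ hρ₁, ← integral_sub hui hvi, ← integral_const_mul]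
  exact integral_mono ((hui.sub hvi).const_mul _) hI
    fun x => (forch_point d ρ hρ₁ (u x) (v x)).1
end

section
/- Let E be a real Banach space, T > 0, N a positive integer, Δt := T/N, and t_n := n·Δt for n = 0, …, N. Let u : ℝ → E be twice continuously differentiable on [0, T]. Then Σ_{n=1}^{N} Δt·‖(u(t_n) − u(t_{n−1}))/Δt − u'(t_n)‖² ≤ ((Δt)²/3)·∫₀^T ‖u''(s)‖² ds. -/
open MeasureTheory Finset

theorem be_cs (a b : ℝ) (hab : a < b) (g : ℝ → ℝ) (hg : ContinuousOn g (Set.Icc a b)) :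
    (∫ s in a..b, (s - a) * g s) ^ 2 ≤ (b - a) ^ 3 / 3 * ∫ s in a..b, g s ^ 2 := by
  have hu : Set.uIcc a b = Set.Icc a b := Set.uIcc_of_le hab.le
  have key : ∀ c : ℝ, 0 ≤ c ^ 2 * ((b - a) ^ 3 / 3) - 2 * c * (∫ s in a..b, (s - a) * g s)
      + ∫ s in a..b, g s ^ 2 := by
    intro c
    have h0 : 0 ≤ ∫ s in a..b, ((s - a) * c - g s) ^ 2 :=
      intervalIntegral.integral_nonneg hab.le (fun s _ => sq_nonneg _)
    have i1 : IntervalIntegrable (fun s => c ^ 2 * (s - a) ^ 2) volume a b :=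
      Continuous.intervalIntegrable (by fun_prop) _ _
    have i2 : IntervalIntegrable (fun s => 2 * c * ((s - a) * g s)) volume a b :=
      ContinuousOn.intervalIntegrable (by rw [hu]; fun_prop)
    have i3 : IntervalIntegrable (fun s => g s ^ 2) volume a b :=
      ContinuousOn.intervalIntegrable (by rw [hu]; fun_prop)
    have e : (∫ s in a..b, ((s - a) * c - g s) ^ 2)
        = ∫ s in a..b, (c ^ 2 * (s - a) ^ 2 - 2 * c * ((s - a) * g s) + g s ^ 2) := by
      congr 1; funext s; ring
    have e2 : ∫ s in a..b, (s - a) ^ 2 = (b - a) ^ 3 / 3 := by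
      rw [intervalIntegral.integral_comp_sub_right (fun x => x ^ 2) a, integral_pow]
      norm_num
    rw [e, intervalIntegral.integral_add (i1.sub i2) i3, intervalIntegral.integral_sub i1 i2,
      intervalIntegral.integral_const_mul, intervalIntegral.integral_const_mul, e2] at h0
    exact h0
  have hp : 0 < (b - a) ^ 3 / 3 := by
    have := sub_pos.2 hab
    positivity
  generalize (∫ s in a..b, (s - a) * g s) = I at *
  generalize (∫ s in a..b, g s ^ 2) = J at *
  generalize (b - a) ^ 3 / 3 = K at *
  have h := mul_nonneg hp.le (key (I / K))
  have : K * ((I / K) ^ 2 * K - 2 * (I / K) * I + J) = K * J - I ^ 2 := by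
    field_simp; ring
  linarith

theorem be_local {E : Type*} [NormedAddCommGroup E] [NormedSpace ℝ E] [CompleteSpace E]
    (a b : ℝ) (hab : a < b) (u v w : ℝ → E) (hu : ContinuousOn u (Set.Icc a b))
    (hv : ContinuousOn v (Set.Icc a b)) (hw : ContinuousOn w (Set.Icc a b))
    (hu' : ∀ s ∈ Set.Ioo a b, HasDerivAt u (v s) s)
    (hv' : ∀ s ∈ Set.Ioo a b, HasDerivAt v (w s) s) :
    (b - a) * ‖(b - a)⁻¹ • (u b - u a) - v b‖ ^ 2 ≤
      (b - a) ^ 2 / 3 * ∫ s in a..b, ‖w s‖ ^ 2 := by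
  have hI : Set.uIcc a b = Set.Icc a b := Set.uIcc_of_le hab.le
  have hpos := sub_pos.2 hab
  have ftc : ∫ s in a..b, -((s - a) • w s) = (u b - (b - a) • v b) - (u a - (a - a) • v a) := by
    refine intervalIntegral.integral_eq_sub_of_hasDerivAt_of_le
      (f := fun s => u s - (s - a) • v s) hab.le (by fun_prop) ?_
      (ContinuousOn.intervalIntegrable (by rw [hI]; fun_prop))
    intro s hs
    have h1 := (hu' s hs).sub ((((hasDerivAt_id s).sub_const a)).smul (hv' s hs))
    convert h1 using 1
    · rfl
    · simp only [id, one_smul]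
      abel
  have e : (b - a)⁻¹ • (u b - u a) - v b = (b - a)⁻¹ • ∫ s in a..b, -((s - a) • w s) := by
    rw [ftc, sub_self, zero_smul, sub_zero, sub_right_comm, smul_sub _ (u b - u a),
      inv_smul_smul₀ hpos.ne']
  have hn : ‖∫ s in a..b, -((s - a) • w s)‖ ≤ ∫ s in a..b, (s - a) * ‖w s‖ := by
    refine (intervalIntegral.norm_integral_le_integral_norm hab.le).trans (le_of_eq ?_)
    refine intervalIntegral.integral_congr ?_
    intro s hs
    rw [hI] at hs
    simp only [norm_neg, norm_smul, Real.norm_eq_abs]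
    rw [abs_of_nonneg (sub_nonneg.2 hs.1)]
  have hc := be_cs a b hab (fun s => ‖w s‖) hw.norm
  have h2 := (pow_le_pow_left₀ (norm_nonneg _) hn 2).trans hc
  rw [e, norm_smul, mul_pow, Real.norm_eq_abs, sq_abs]
  calc _ = (b - a)⁻¹ * ‖∫ s in a..b, -((s - a) • w s)‖ ^ 2 := by field_simp
    _ ≤ (b - a)⁻¹ * _ := mul_le_mul_of_nonneg_left h2 (by positivity)
    _ = _ := by field_simp

/-- **Consistency estimate for the backward Euler difference quotient.** Let `E` be a real
Banach space, `T > 0`, `N ≥ 1`, `Δt = T/N`, `t_n = n·Δt`, and let `u : ℝ → E` be twice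
continuously differentiable on `[0, T]`. Then
`Σ_{n=1}^{N} Δt·‖(u(t_n) − u(t_{n−1}))/Δt − u'(t_n)‖² ≤ ((Δt)²/3)·∫₀^T ‖u''(s)‖² ds`. -/
theorem backward_euler_consistency (E : Type*) [NormedAddCommGroup E] [NormedSpace ℝ E]
    [CompleteSpace E] (T : ℝ) (hT : 0 < T) (N : ℕ) (hN : 0 < N)
    (Δt : ℝ) (hΔt : Δt = T / N) (t : ℕ → ℝ) (ht : ∀ n, t n = n * Δt)
    (u : ℝ → E) (hu : ContDiffOn ℝ 2 u (Set.Icc 0 T)) :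
    ∑ n ∈ Icc 1 N,
        Δt * ‖Δt⁻¹ • (u (t n) - u (t (n - 1))) - derivWithin u (Set.Icc 0 T) (t n)‖ ^ 2 ≤
      Δt ^ 2 / 3 * ∫ s in (0 : ℝ)..T, ‖iteratedDerivWithin 2 u (Set.Icc 0 T) s‖ ^ 2 := by
  have hNr : (0 : ℝ) < N := by exact_mod_cast hN
  have hd : 0 < Δt := by rw [hΔt]; positivity
  have hNT : (N : ℝ) * Δt = T := by rw [hΔt]; field_simp
  have hU : UniqueDiffOn ℝ (Set.Icc 0 T) := uniqueDiffOn_Icc hT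
  have hv1 : ContDiffOn ℝ 1 (derivWithin u (Set.Icc 0 T)) (Set.Icc 0 T) :=
    hu.derivWithin hU (by norm_num)
  have hwc : ContinuousOn (iteratedDerivWithin 2 u (Set.Icc 0 T)) (Set.Icc 0 T) :=
    hu.continuousOn_iteratedDerivWithin le_rfl hU
  have hw2 : iteratedDerivWithin 2 u (Set.Icc 0 T)
      = derivWithin (derivWithin u (Set.Icc 0 T)) (Set.Icc 0 T) := by
    rw [iteratedDerivWithin_succ', iteratedDerivWithin_one]
  have hu' : ∀ s ∈ Set.Ioo 0 T, HasDerivAt u (derivWithin u (Set.Icc 0 T) s) s := fun s hs =>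
    ((hu.differentiableOn (by norm_num)) s (Set.Ioo_subset_Icc_self hs)).hasDerivWithinAt.hasDerivAt
      (Icc_mem_nhds hs.1 hs.2)
  have hv' : ∀ s ∈ Set.Ioo 0 T, HasDerivAt (derivWithin u (Set.Icc 0 T))
      (iteratedDerivWithin 2 u (Set.Icc 0 T) s) s := fun s hs => by
    rw [hw2]
    exact ((hv1.differentiableOn (by norm_num)) s
      (Set.Ioo_subset_Icc_self hs)).hasDerivWithinAt.hasDerivAt (Icc_mem_nhds hs.1 hs.2)
  have hstep : ∀ k, t (k + 1) - t k = Δt := fun k => by rw [ht, ht]; push_cast; ring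
  have hlt : ∀ k, t k < t (k + 1) := fun k => by linarith [hstep k]
  have h0 : ∀ k, 0 ≤ t k := fun k => by rw [ht]; positivity
  have hle : ∀ k, k ≤ N → t k ≤ T := fun k hk => by
    rw [ht, ← hNT]; gcongr
  have ht0 : t 0 = 0 := by rw [ht]; simp
  have htN : t N = T := by rw [ht, hNT]
  have hsub : ∀ k < N, Set.Icc (t k) (t (k + 1)) ⊆ Set.Icc 0 T := fun k hk =>
    Set.Icc_subset_Icc (h0 k) (hle _ hk)
  have hsubo : ∀ k < N, Set.Ioo (t k) (t (k + 1)) ⊆ Set.Ioo 0 T := fun k hk =>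
    Set.Ioo_subset_Ioo (h0 k) (hle _ hk)
  have hsum : ∑ k ∈ range N, ∫ s in (t k)..(t (k + 1)),
      ‖iteratedDerivWithin 2 u (Set.Icc 0 T) s‖ ^ 2
      = ∫ s in (0 : ℝ)..T, ‖iteratedDerivWithin 2 u (Set.Icc 0 T) s‖ ^ 2 := by
    rw [intervalIntegral.sum_integral_adjacent_intervals, ht0, htN]
    intro k hk
    refine ContinuousOn.intervalIntegrable ?_
    rw [Set.uIcc_of_le (hlt k).le]
    exact ((hwc.mono (hsub k hk)).norm).pow 2
  rw [← hsum, mul_sum, ← Finset.Ico_add_one_right_eq_Icc, Finset.sum_Ico_eq_sum_range]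
  simp only [Nat.add_sub_cancel]
  refine sum_le_sum fun k hk => ?_
  have hk := Finset.mem_range.1 hk
  rw [add_comm 1 k, Nat.add_sub_cancel]
  have := be_local (t k) (t (k + 1)) (hlt k) u _ _ (hu.continuousOn.mono (hsub k hk))
    (hv1.continuousOn.mono (hsub k hk)) (hwc.mono (hsub k hk))
    (fun s hs => hu' s (hsubo k hk hs)) (fun s hs => hv' s (hsubo k hk hs))
  rwa [hstep] at this
end
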